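/- Fix ℓ ∈ ℕ and let f ∈ C^{ℓ+1}(ℝ) with f^{(ℓ+1)} bounded on ℝ, and let ξ be a bounded real random variable with k-th cumulants κ_k(ξ). Then E(ξ f(ξ)) = ∑_{k=0}^{ℓ} κ_{k+1}(ξ)/k! · E(f^{(k)}(ξ)) + E(r_ℓ(ξ f(ξ))), where the remainder satisfies, for every s > 0, |E(r_ℓ(ξ f(ξ)))| ≤ C_ℓ E(|ξ|^{ℓ+2}) · sup_{|t| ≤ s} |f^{(ℓ+1)}(t)| + C_ℓ E(|ξ|^{ℓ+2} 1(|ξ| > s)) · sup_{t ∈ ℝ} |f^{(ℓ+1)}(t)|, with a constant C_ℓ satisfying C_ℓ ≤ (Cℓ)^ℓ/ℓ! for some absolute constant C > 0. -/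

import Mathlib

open MeasureTheory ProbabilityTheory

/-- Taylor's theorem at `0` for the `j`-th derivative, with a crude two-sided remainder bound. -/
lemma abs_iteratedDeriv_sub_taylor_le {f : ℝ → ℝ} (n j : ℕ) (hf : ContDiff ℝ (j + n : ℕ) f)
    {D x : ℝ} (hD : ∀ t, |t| ≤ |x| → |iteratedDeriv (j + n) f t| ≤ D) :
    |iteratedDeriv j f x -
      ∑ i ∈ Finset.range n, iteratedDeriv (j + i) f 0 / (Nat.factorial i : ℝ) * x ^ i| ≤
      D * |x| ^ n := by
  induction n generalizing j x with
  | zero => simpa using hD x le_rfl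
  | succ n ih =>
    have hD0 : 0 ≤ D := (abs_nonneg _).trans (hD 0 (by simp))
    set h : ℝ → ℝ := fun y ↦ iteratedDeriv j f y -
      ∑ i ∈ Finset.range (n + 1), iteratedDeriv (j + i) f 0 / (Nat.factorial i : ℝ) * y ^ i
    set h' : ℝ → ℝ := fun y ↦ iteratedDeriv (j + 1) f y -
      ∑ i ∈ Finset.range n, iteratedDeriv (j + 1 + i) f 0 / (Nat.factorial i : ℝ) * y ^ i
    have hder : ∀ y, HasDerivAt h (h' y) y := by
      intro y
      refine HasDerivAt.sub ?_ ?_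
      · rw [iteratedDeriv_succ]
        exact (hf.differentiable_iteratedDeriv j
          (by exact_mod_cast (by omega : j < j + (n + 1))) y).hasDerivAt
      · simp only [Finset.sum_range_succ', pow_zero]
        refine HasDerivAt.add_const _ (HasDerivAt.fun_sum fun i _ ↦ ?_)
        refine ((hasDerivAt_pow (i + 1) y).const_mul _).congr_deriv ?_
        rw [Nat.factorial_succ, show j + (i + 1) = j + 1 + i by ring]
        have : (Nat.factorial i : ℝ) ≠ 0 := by positivity
        push_cast
        field_simp
    have hbound : ∀ y ∈ Set.Icc (-|x|) |x|, ‖h' y‖ ≤ D * |x| ^ n := by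
      intro y hy
      have hy' : |y| ≤ |x| := abs_le.2 hy
      have heq : j + 1 + n = j + (n + 1) := by ring
      refine (ih (j + 1) (by rwa [heq]) (x := y) fun t ht ↦ ?_).trans (by gcongr)
      rw [heq]
      exact hD t (ht.trans hy')
    have key := Convex.norm_image_sub_le_of_norm_hasDerivWithin_le
      (fun y _ ↦ (hder y).hasDerivWithinAt) hbound (convex_Icc _ _)
      (show (0 : ℝ) ∈ Set.Icc (-|x|) |x| by simp) (show x ∈ Set.Icc (-|x|) |x| from
        ⟨neg_abs_le x, le_abs_self x⟩)
    have h0 : h 0 = 0 := by simp [h, Finset.sum_range_succ']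
    rw [h0, sub_zero, sub_zero, Real.norm_eq_abs, Real.norm_eq_abs] at key
    rw [pow_succ, ← mul_assoc]
    exact key

section

variable {Ω : Type*} [MeasurableSpace Ω] {μ : Measure Ω} [IsProbabilityMeasure μ] {ξ : Ω → ℝ}

/-- Twice a covariance as an integral of products of increments over two independent copies. -/
lemma integral_prod_sub_mul_sub {g h : Ω → ℝ} (hg : Integrable g μ) (hh : Integrable h μ)
    (hgh : Integrable (fun ω ↦ g ω * h ω) μ) :
    Integrable (fun z : Ω × Ω ↦ (g z.1 - g z.2) * (h z.1 - h z.2)) (μ.prod μ) ∧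
    ∫ z : Ω × Ω, (g z.1 - g z.2) * (h z.1 - h z.2) ∂(μ.prod μ) =
      2 * (∫ ω, g ω * h ω ∂μ - (∫ ω, g ω ∂μ) * ∫ ω, h ω ∂μ) := by
  have h1 := hgh.comp_fst μ
  have h2 := hgh.comp_snd μ
  have h3 := hg.mul_prod hh
  have h4 := hh.mul_prod hg
  have heq : (fun z : Ω × Ω ↦ (g z.1 - g z.2) * (h z.1 - h z.2)) = fun z ↦
      (g z.1 * h z.1 + g z.2 * h z.2) - (g z.1 * h z.2 + h z.1 * g z.2) := by
    ext z; ring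
  rw [heq]
  refine ⟨(h1.add h2).sub (h3.add h4), ?_⟩
  rw [integral_sub (by exact h1.add h2) (by exact h3.add h4), integral_add h1 h2, integral_add h3 h4,
    integral_prod_mul, integral_prod_mul, integral_fun_fst (fun ω ↦ g ω * h ω),
    integral_fun_snd (fun ω ↦ g ω * h ω)]
  simp
  ring

/-- Chebyshev's association inequality. -/
lemma integral_mul_integral_le {g h : Ω → ℝ} (hg : Integrable g μ) (hh : Integrable h μ)
    (hgh : Integrable (fun ω ↦ g ω * h ω) μ)
    (hmono : ∀ x y, 0 ≤ (g x - g y) * (h x - h y)) :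
    (∫ ω, g ω ∂μ) * ∫ ω, h ω ∂μ ≤ ∫ ω, g ω * h ω ∂μ := by
  have h1 := (integral_prod_sub_mul_sub hg hh hgh).2
  have h2 : 0 ≤ ∫ z : Ω × Ω, (g z.1 - g z.2) * (h z.1 - h z.2) ∂(μ.prod μ) :=
    integral_nonneg fun z ↦ hmono z.1 z.2
  linarith

lemma integrable_comp_of_bounded (hξ : Measurable ξ) {M : ℝ} (hM : ∀ ω, |ξ ω| ≤ M)
    {g : ℝ → ℝ} (hg : Continuous g) : Integrable (fun ω ↦ g (ξ ω)) μ := by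
  obtain ⟨C, hC⟩ := isCompact_Icc.exists_bound_of_continuousOn (s := Set.Icc (-M) M)
    hg.continuousOn
  exact Integrable.of_bound (hg.measurable.comp hξ).aestronglyMeasurable C
    (.of_forall fun ω ↦ hC _ (abs_le.1 (hM ω)))

lemma integrable_indicator_abs_pow (hξ : Measurable ξ) {M : ℝ} (hM : ∀ ω, |ξ ω| ≤ M)
    (s : ℝ) (p : ℕ) :
    Integrable ({ω | s < |ξ ω|}.indicator fun ω ↦ |ξ ω| ^ p) μ :=
  (integrable_comp_of_bounded hξ hM (g := fun x ↦ |x| ^ p) (by fun_prop)).indicator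
    (measurableSet_lt measurable_const hξ.abs)

lemma integral_abs_pow_mul_setIntegral_le (hξ : Measurable ξ) {M : ℝ} (hM : ∀ ω, |ξ ω| ≤ M)
    (s : ℝ) (p q : ℕ) :
    (∫ ω, |ξ ω| ^ p ∂μ) * ∫ ω in {ω | s < |ξ ω|}, |ξ ω| ^ q ∂μ ≤
      ∫ ω in {ω | s < |ξ ω|}, |ξ ω| ^ (p + q) ∂μ := by
  have hS : MeasurableSet {ω | s < |ξ ω|} := measurableSet_lt measurable_const hξ.abs
  have heq : (fun ω ↦ |ξ ω| ^ p * {ω | s < |ξ ω|}.indicator (fun ω ↦ |ξ ω| ^ q) ω) =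
      {ω | s < |ξ ω|}.indicator fun ω ↦ |ξ ω| ^ (p + q) := by
    ext ω
    by_cases h : s < |ξ ω| <;> simp [h, pow_add]
  rw [← integral_indicator hS, ← integral_indicator hS, ← heq]
  refine integral_mul_integral_le (integrable_comp_of_bounded hξ hM (g := fun x ↦ |x| ^ p)
    (by fun_prop)) (integrable_indicator_abs_pow hξ hM s q)
    (heq ▸ integrable_indicator_abs_pow hξ hM s (p + q)) ?_
  have hle : ∀ x y, |ξ x| ≤ |ξ y| → {ω | s < |ξ ω|}.indicator (fun ω ↦ |ξ ω| ^ q) x ≤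
      {ω | s < |ξ ω|}.indicator (fun ω ↦ |ξ ω| ^ q) y := by
    intro x y hxy
    by_cases hx : s < |ξ x|
    · simp only [Set.indicator, Set.mem_ofPred_eq, hx, hx.trans_le hxy, if_true]
      gcongr
    · simp only [Set.indicator, Set.mem_ofPred_eq, hx, if_false]
      split_ifs <;> positivity
  intro x y
  rcases le_total |ξ x| |ξ y| with h | h
  · exact mul_nonneg_of_nonpos_of_nonpos (sub_nonpos.2 (by gcongr)) (sub_nonpos.2 (hle x y h))
  · exact mul_nonneg (sub_nonneg.2 (by gcongr)) (sub_nonneg.2 (hle y x h))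

lemma integral_abs_pow_mul_le (hξ : Measurable ξ) {M : ℝ} (hM : ∀ ω, |ξ ω| ≤ M) (p q : ℕ) :
    (∫ ω, |ξ ω| ^ p ∂μ) * ∫ ω, |ξ ω| ^ q ∂μ ≤ ∫ ω, |ξ ω| ^ (p + q) ∂μ := by
  have huniv : {ω | -1 < |ξ ω|} = Set.univ :=
    Set.eq_univ_of_forall fun ω ↦ lt_of_lt_of_le (by norm_num) (abs_nonneg (ξ ω))
  simpa [huniv] using integral_abs_pow_mul_setIntegral_le (μ := μ) hξ hM (-1) p q

/-- The recursion between moments and cumulants. -/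
lemma integral_pow_succ_eq_sum_cumulant (hξ : Measurable ξ) {M : ℝ} (hM : ∀ ω, |ξ ω| ≤ M)
    (k : ℕ) :
    ∫ ω, ξ ω ^ (k + 1) ∂μ = ∑ j ∈ Finset.range (k + 1),
      (k.choose j : ℝ) * iteratedDeriv (j + 1) (cgf ξ μ) 0 * ∫ ω, ξ ω ^ (k - j) ∂μ := by
  have hint : integrableExpSet ξ μ = Set.univ := by
    ext t
    simpa using! integrable_comp_of_bounded hξ hM (g := fun x ↦ Real.exp (t * x)) (by fun_prop)
  have hmem : ∀ t, t ∈ interior (integrableExpSet ξ μ) := by simp [hint]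
  have hderiv : deriv (mgf ξ μ) = deriv (cgf ξ μ) * mgf ξ μ := by
    ext t
    have hpos : mgf ξ μ t ≠ 0 := (mgf_pos (interior_subset (s := integrableExpSet ξ μ) (hmem t))).ne'
    rw [Pi.mul_apply, deriv_cgf (hmem t), deriv_mgf (hmem t), div_mul_cancel₀ _ hpos]
  have h1 := iteratedDeriv_mgf_zero (hmem 0) (k + 1)
  rw [iteratedDeriv_succ', hderiv, iteratedDeriv_mul (analyticAt_cgf (hmem 0)).deriv.contDiffAt
    (analyticAt_mgf (hmem 0)).contDiffAt] at h1
  simp only [← iteratedDeriv_succ', iteratedDeriv_mgf_zero (hmem 0), Pi.pow_apply] at h1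
  exact h1.symm

lemma abs_cumulant_le (hξ : Measurable ξ) {M : ℝ} (hM : ∀ ω, |ξ ω| ≤ M) (k : ℕ) :
    |iteratedDeriv (k + 1) (cgf ξ μ) 0| ≤
      2 ^ k * (Nat.factorial k : ℝ) * ∫ ω, |ξ ω| ^ (k + 1) ∂μ := by
  induction k using Nat.strong_induction_on with
  | _ k ih =>
  have habs : ∀ n : ℕ, |∫ ω, ξ ω ^ n ∂μ| ≤ ∫ ω, |ξ ω| ^ n ∂μ := fun n ↦ by
    simpa [abs_pow] using abs_integral_le_integral_abs (f := fun ω ↦ ξ ω ^ n) (μ := μ)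
  have hnn : ∀ n : ℕ, 0 ≤ ∫ ω, |ξ ω| ^ n ∂μ := fun n ↦ integral_nonneg fun ω ↦ by positivity
  have hrec := integral_pow_succ_eq_sum_cumulant (μ := μ) hξ hM k
  rw [Finset.sum_range_succ] at hrec
  simp only [Nat.choose_self, Nat.cast_one, one_mul, Nat.sub_self, pow_zero, integral_const,
    probReal_univ, smul_eq_mul, mul_one] at hrec
  have hterm : ∀ j ∈ Finset.range k,
      |(k.choose j : ℝ) * iteratedDeriv (j + 1) (cgf ξ μ) 0 * ∫ ω, ξ ω ^ (k - j) ∂μ| ≤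
      2 ^ j * ((Nat.factorial k : ℝ) * ∫ ω, |ξ ω| ^ (k + 1) ∂μ) := by
    intro j hj
    have hjk := Finset.mem_range.1 hj
    rw [abs_mul, abs_mul, Nat.abs_cast]
    have hprod := integral_abs_pow_mul_le (μ := μ) hξ hM (j + 1) (k - j)
    rw [show j + 1 + (k - j) = k + 1 by omega] at hprod
    have hfact : (k.choose j : ℝ) * (Nat.factorial j : ℝ) ≤ Nat.factorial k := by
      rw [← Nat.choose_mul_factorial_mul_factorial hjk.le]
      exact_mod_cast Nat.le_mul_of_pos_right _ (Nat.factorial_pos _)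
    calc _ ≤ (k.choose j : ℝ) * (2 ^ j * (Nat.factorial j : ℝ) * ∫ ω, |ξ ω| ^ (j + 1) ∂μ) *
          ∫ ω, |ξ ω| ^ (k - j) ∂μ := by
          gcongr
          exacts [ih j hjk, habs _]
      _ = 2 ^ j * (((k.choose j : ℝ) * (Nat.factorial j : ℝ)) *
          ((∫ ω, |ξ ω| ^ (j + 1) ∂μ) * ∫ ω, |ξ ω| ^ (k - j) ∂μ)) := by ring
      _ ≤ _ := by gcongr
  have hsum := (Finset.abs_sum_le_sum_abs _ _).trans (Finset.sum_le_sum hterm)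
  rw [← Finset.sum_mul, geom_sum_eq (by norm_num)] at hsum
  have hfirst : |∫ ω, ξ ω ^ (k + 1) ∂μ| ≤ (Nat.factorial k : ℝ) * ∫ ω, |ξ ω| ^ (k + 1) ∂μ :=
    (habs _).trans (le_mul_of_one_le_left (hnn _) (by exact_mod_cast Nat.factorial_pos k))
  rw [← sub_eq_iff_eq_add'.2 hrec]
  refine (abs_sub _ _).trans ?_
  linarith

/-- An increment of a function which is `A`-Lipschitz on `[-s, s]` and `B`-Lipschitz on `ℝ`,
in terms of the increment of the truncation `x ↦ x 1(|x| > s)`. -/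
lemma abs_sub_mul_abs_sub_le {f : ℝ → ℝ} {s A B : ℝ} (hs : 0 ≤ s) (hA0 : 0 ≤ A) (hB0 : 0 ≤ B)
    (hA : ∀ x y, |x| ≤ s → |y| ≤ s → |f x - f y| ≤ A * |x - y|)
    (hB : ∀ x y, |f x - f y| ≤ B * |x - y|) (x y : ℝ) :
    |x - y| * |f x - f y| ≤ A * (x - y) ^ 2 +
      B * ((if s < |x| then x else 0) - (if s < |y| then y else 0)) ^ 2 := by
  have mixed : ∀ x y : ℝ, s < |x| → |y| ≤ s →
      |x - y| * |f x - f y| ≤ A * (x - y) ^ 2 + B * x ^ 2 := by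
    intro x y hx hy
    obtain ⟨c, hc, hxc, hcy⟩ : ∃ c, |c| ≤ s ∧ |x - c| = |x| - s ∧ |c - y| ≤ |x - y| := by
      have hy' := abs_le.1 hy
      rcases le_total 0 x with h0 | h0
      · rw [abs_of_nonneg h0] at hx ⊢
        refine ⟨s, (abs_of_nonneg hs).le, abs_of_pos (by linarith), ?_⟩
        rw [abs_of_nonneg, abs_of_nonneg] <;> linarith
      · rw [abs_of_nonpos h0] at hx ⊢
        refine ⟨-s, by rw [abs_neg, abs_of_nonneg hs], ?_, ?_⟩
        · rw [abs_of_nonpos] <;> linarith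
        · rw [abs_of_nonpos, abs_of_nonpos] <;> linarith
    have h1 : |f x - f y| ≤ B * (|x| - s) + A * |x - y| := by
      calc |f x - f y| ≤ |f x - f c| + |f c - f y| := abs_sub_le _ _ _
        _ ≤ B * |x - c| + A * |c - y| := add_le_add (hB _ _) (hA _ _ hc hy)
        _ ≤ _ := by rw [hxc]; gcongr
    have h2 : |x - y| ≤ |x| + s := (abs_sub _ _).trans (by linarith)
    have h3 : |x - y| * (|x| - s) ≤ x ^ 2 := by
      calc |x - y| * (|x| - s) ≤ (|x| + s) * (|x| - s) :=
            mul_le_mul_of_nonneg_right h2 (by linarith)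
        _ = x ^ 2 - s ^ 2 := by rw [← sq_abs x]; ring
        _ ≤ x ^ 2 := by linarith [sq_nonneg s]
    calc |x - y| * |f x - f y| ≤ |x - y| * (B * (|x| - s) + A * |x - y|) := by gcongr
      _ = A * (x - y) ^ 2 + B * (|x - y| * (|x| - s)) := by rw [← sq_abs (x - y)]; ring
      _ ≤ _ := by gcongr
  by_cases hx : s < |x| <;> by_cases hy : s < |y|
  · rw [if_pos hx, if_pos hy]
    calc |x - y| * |f x - f y| ≤ |x - y| * (B * |x - y|) := by gcongr; exact hB x y
      _ = B * (x - y) ^ 2 := by rw [← sq_abs (x - y)]; ring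
      _ ≤ _ := le_add_of_nonneg_left (by positivity)
  · rw [if_pos hx, if_neg hy, sub_zero]
    exact mixed x y hx (not_lt.1 hy)
  · rw [if_neg hx, if_pos hy, abs_sub_comm x, abs_sub_comm (f x), zero_sub, neg_sq, sub_sq_comm]
    exact mixed y x hy (not_lt.1 hx)
  · rw [if_neg hx, if_neg hy]
    calc |x - y| * |f x - f y| ≤ |x - y| * (A * |x - y|) := by
          gcongr; exact hA x y (not_lt.1 hx) (not_lt.1 hy)
      _ = A * (x - y) ^ 2 := by rw [← sq_abs (x - y)]; ring
      _ ≤ _ := le_add_of_nonneg_right (by positivity)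

/-- A covariance bound with sharp constant for `ξ` and a Lipschitz function of `ξ`. -/
lemma abs_integral_mul_sub_le (hξ : Measurable ξ) {M : ℝ} (hM : ∀ ω, |ξ ω| ≤ M)
    {f : ℝ → ℝ} (hf : Continuous f) {s A B : ℝ} (hs : 0 ≤ s) (hA0 : 0 ≤ A) (hB0 : 0 ≤ B)
    (hA : ∀ x y, |x| ≤ s → |y| ≤ s → |f x - f y| ≤ A * |x - y|)
    (hB : ∀ x y, |f x - f y| ≤ B * |x - y|) :
    |∫ ω, ξ ω * f (ξ ω) ∂μ - (∫ ω, ξ ω ∂μ) * ∫ ω, f (ξ ω) ∂μ| ≤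
      A * ∫ ω, |ξ ω| ^ 2 ∂μ + B * ∫ ω in {ω | s < |ξ ω|}, |ξ ω| ^ 2 ∂μ := by
  have hS : MeasurableSet {ω | s < |ξ ω|} := measurableSet_lt measurable_const hξ.abs
  set a : Ω → ℝ := fun ω ↦ if s < |ξ ω| then ξ ω else 0 with ha
  have hIξ : Integrable ξ μ := integrable_comp_of_bounded hξ hM (g := fun x ↦ x) (by fun_prop)
  have hIa : Integrable a μ := by
    convert! hIξ.indicator hS using 1
  have haa : (fun ω ↦ a ω * a ω) = {ω | s < |ξ ω|}.indicator fun ω ↦ |ξ ω| ^ 2 := by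
    ext ω
    by_cases h : s < |ξ ω| <;> simp [ha, h, sq]
  have hξξ : (fun ω ↦ ξ ω * ξ ω) = fun ω ↦ |ξ ω| ^ 2 := by
    ext ω; rw [sq_abs, sq]
  obtain ⟨-, e1⟩ := integral_prod_sub_mul_sub hIξ
    (integrable_comp_of_bounded hξ hM hf) (μ := μ)
    (integrable_comp_of_bounded hξ hM (g := fun x ↦ x * f x) (by fun_prop))
  obtain ⟨i2, e2⟩ := integral_prod_sub_mul_sub hIξ hIξ (μ := μ)
    (integrable_comp_of_bounded hξ hM (g := fun x ↦ x * x) (by fun_prop))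
  obtain ⟨i3, e3⟩ := integral_prod_sub_mul_sub hIa hIa (μ := μ)
    (haa ▸ integrable_indicator_abs_pow hξ hM s 2)
  have hle := norm_integral_le_of_norm_le ((i2.const_mul A).add (i3.const_mul B))
    (f := fun z : Ω × Ω ↦ (ξ z.1 - ξ z.2) * (f (ξ z.1) - f (ξ z.2))) (.of_forall fun z ↦ by
      rw [norm_mul, Real.norm_eq_abs, Real.norm_eq_abs]
      simpa [sq] using abs_sub_mul_abs_sub_le hs hA0 hB0 hA hB (ξ z.1) (ξ z.2))
  simp only [Pi.add_apply] at hle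
  rw [integral_add (i2.const_mul A) (i3.const_mul B), integral_const_mul, integral_const_mul,
    e1, e2, e3, haa, hξξ, integral_indicator hS, Real.norm_eq_abs, abs_mul,
    abs_of_pos (two_pos : (0 : ℝ) < 2)] at hle
  have h1 : 0 ≤ A * ((∫ ω, ξ ω ∂μ) * ∫ ω, ξ ω ∂μ) := mul_nonneg hA0 (mul_self_nonneg _)
  have h2 : 0 ≤ B * ((∫ ω, a ω ∂μ) * ∫ ω, a ω ∂μ) := mul_nonneg hB0 (mul_self_nonneg _)
  linarith

/-- The remainder of the cumulant expansion of order `ℓ`. -/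
noncomputable def cumulantRemainder (ξ : Ω → ℝ) (f : ℝ → ℝ) (ℓ : ℕ) (μ : Measure Ω) : ℝ :=
  ∫ ω, ξ ω * f (ξ ω) ∂μ - ∑ k ∈ Finset.range (ℓ + 1),
    iteratedDeriv (k + 1) (cgf ξ μ) 0 / (Nat.factorial k : ℝ) * ∫ ω, iteratedDeriv k f (ξ ω) ∂μ

/-- The remainder of the cumulant expansion in terms of Taylor remainders at `0`. -/
lemma cumulantRemainder_eq (hξ : Measurable ξ) {M : ℝ} (hM : ∀ ω, |ξ ω| ≤ M)
    {f : ℝ → ℝ} {ℓ : ℕ} (hf : ContDiff ℝ (ℓ + 1 : ℕ) f) {R : ℕ → ℝ → ℝ}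
    (hR : R = fun j x ↦ iteratedDeriv j f x - ∑ i ∈ Finset.range (ℓ + 1 - j),
      iteratedDeriv (j + i) f 0 / (Nat.factorial i : ℝ) * x ^ i) :
    cumulantRemainder ξ f ℓ μ = ∫ ω, ξ ω * R 0 (ξ ω) ∂μ - ∑ j ∈ Finset.range (ℓ + 1),
      iteratedDeriv (j + 1) (cgf ξ μ) 0 / (Nat.factorial j : ℝ) * ∫ ω, R j (ξ ω) ∂μ := by
  have hcont : ∀ j ∈ Finset.range (ℓ + 1), Continuous (iteratedDeriv j f) := fun j hj ↦
    hf.continuous_iteratedDeriv j (by exact_mod_cast (Finset.mem_range.1 hj).le)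
  have hcontR : ∀ j ∈ Finset.range (ℓ + 1), Continuous (R j) := fun j hj ↦ by
    have := hcont j hj
    rw [hR]
    fun_prop
  have hfirst : ∫ ω, ξ ω * f (ξ ω) ∂μ = ∫ ω, ξ ω * R 0 (ξ ω) ∂μ +
      ∑ k ∈ Finset.range (ℓ + 1),
        iteratedDeriv k f 0 / (Nat.factorial k : ℝ) * ∫ ω, ξ ω ^ (k + 1) ∂μ := by
    have hR0 := hcontR 0 (by simp)
    simp only [← integral_const_mul]
    rw [← integral_finsetSum _ fun k _ ↦ integrable_comp_of_bounded hξ hM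
      (g := fun x ↦ iteratedDeriv k f 0 / (Nat.factorial k : ℝ) * x ^ (k + 1)) (by fun_prop),
      ← integral_add (integrable_comp_of_bounded hξ hM (g := fun x ↦ x * R 0 x) (by fun_prop))
        (integrable_comp_of_bounded hξ hM (g := fun x ↦ ∑ k ∈ Finset.range (ℓ + 1),
          iteratedDeriv k f 0 / (Nat.factorial k : ℝ) * x ^ (k + 1)) (by fun_prop))]
    congr 1 with ω
    simp only [hR, iteratedDeriv_zero, Nat.sub_zero, zero_add, mul_sub, Finset.mul_sum]
    rw [sub_add, eq_comm, sub_eq_self, sub_eq_zero]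
    exact Finset.sum_congr rfl fun i _ ↦ by ring
  have hder : ∀ j ∈ Finset.range (ℓ + 1), ∫ ω, iteratedDeriv j f (ξ ω) ∂μ =
      ∫ ω, R j (ξ ω) ∂μ + ∑ i ∈ Finset.range (ℓ + 1 - j),
        iteratedDeriv (j + i) f 0 / (Nat.factorial i : ℝ) * ∫ ω, ξ ω ^ i ∂μ := by
    intro j hj
    simp only [← integral_const_mul]
    rw [← integral_finsetSum _ fun i _ ↦ integrable_comp_of_bounded hξ hM
      (g := fun x ↦ iteratedDeriv (j + i) f 0 / (Nat.factorial i : ℝ) * x ^ i) (by fun_prop),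
      ← integral_add (integrable_comp_of_bounded hξ hM (hcontR j hj))
        (integrable_comp_of_bounded hξ hM (g := fun x ↦ ∑ i ∈ Finset.range (ℓ + 1 - j),
          iteratedDeriv (j + i) f 0 / (Nat.factorial i : ℝ) * x ^ i) (by fun_prop))]
    simp only [hR, sub_add_cancel]
  have hswap : ∑ k ∈ Finset.range (ℓ + 1),
        iteratedDeriv k f 0 / (Nat.factorial k : ℝ) * ∫ ω, ξ ω ^ (k + 1) ∂μ =
      ∑ j ∈ Finset.range (ℓ + 1),
        iteratedDeriv (j + 1) (cgf ξ μ) 0 / (Nat.factorial j : ℝ) *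
          ∑ i ∈ Finset.range (ℓ + 1 - j),
            iteratedDeriv (j + i) f 0 / (Nat.factorial i : ℝ) * ∫ ω, ξ ω ^ i ∂μ := by
    simp only [Finset.mul_sum]
    rw [← Finset.sum_range_diag_flip (ℓ + 1) fun j i ↦
      iteratedDeriv (j + 1) (cgf ξ μ) 0 / (Nat.factorial j : ℝ) *
        (iteratedDeriv (j + i) f 0 / (Nat.factorial i : ℝ) * ∫ ω, ξ ω ^ i ∂μ)]
    refine Finset.sum_congr rfl fun k _ ↦ ?_
    rw [integral_pow_succ_eq_sum_cumulant hξ hM, Finset.mul_sum]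
    refine Finset.sum_congr rfl fun j hj ↦ ?_
    have hjk : j ≤ k := Nat.lt_succ_iff.1 (Finset.mem_range.1 hj)
    rw [Nat.add_sub_cancel' hjk, Nat.cast_choose ℝ hjk]
    have h1 : (Nat.factorial k : ℝ) ≠ 0 := by positivity
    have h2 : (Nat.factorial j : ℝ) ≠ 0 := by positivity
    have h3 : (Nat.factorial (k - j) : ℝ) ≠ 0 := by positivity
    field_simp
  have hsum := Finset.sum_congr rfl fun j hj ↦ congrArg
    (iteratedDeriv (j + 1) (cgf ξ μ) 0 / (Nat.factorial j : ℝ) * ·) (hder j hj)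
  simp only [mul_add, Finset.sum_add_distrib] at hsum
  rw [cumulantRemainder, hfirst, hsum, hswap]
  ring

lemma abs_cumulantRemainder_le (hξ : Measurable ξ) {M : ℝ} (hM : ∀ ω, |ξ ω| ≤ M)
    {f : ℝ → ℝ} {ℓ : ℕ} (hf : ContDiff ℝ (ℓ + 1 : ℕ) f) {s A B : ℝ}
    (hA0 : 0 ≤ A) (hB0 : 0 ≤ B)
    (hA : ∀ t, |t| ≤ s → |iteratedDeriv (ℓ + 1) f t| ≤ A)
    (hB : ∀ t, |iteratedDeriv (ℓ + 1) f t| ≤ B) :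
    |cumulantRemainder ξ f ℓ μ| ≤ 2 ^ (ℓ + 1) * (A * ∫ ω, |ξ ω| ^ (ℓ + 2) ∂μ +
      B * ∫ ω in {ω | s < |ξ ω|}, |ξ ω| ^ (ℓ + 2) ∂μ) := by
  have hS : MeasurableSet {ω | s < |ξ ω|} := measurableSet_lt measurable_const hξ.abs
  set R : ℕ → ℝ → ℝ := fun j x ↦ iteratedDeriv j f x - ∑ i ∈ Finset.range (ℓ + 1 - j),
      iteratedDeriv (j + i) f 0 / (Nat.factorial i : ℝ) * x ^ i with hR
  set U : ℝ := A * ∫ ω, |ξ ω| ^ (ℓ + 2) ∂μ +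
      B * ∫ ω in {ω | s < |ξ ω|}, |ξ ω| ^ (ℓ + 2) ∂μ with hU
  have hpt : ∀ j ∈ Finset.range (ℓ + 1), ∀ ω, |R j (ξ ω)| ≤ A * |ξ ω| ^ (ℓ + 1 - j) +
      B * {ω | s < |ξ ω|}.indicator (fun ω ↦ |ξ ω| ^ (ℓ + 1 - j)) ω := by
    intro j hj ω
    have hj' : j + (ℓ + 1 - j) = ℓ + 1 := by have := Finset.mem_range.1 hj; omega
    by_cases h : s < |ξ ω|
    · refine (abs_iteratedDeriv_sub_taylor_le (ℓ + 1 - j) j (by rwa [hj'])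
        (fun t _ ↦ by rw [hj']; exact hB t)).trans ?_
      simp only [Set.indicator, Set.mem_ofPred_eq, h, if_true]
      exact le_add_of_nonneg_left (by positivity)
    · refine (abs_iteratedDeriv_sub_taylor_le (ℓ + 1 - j) j (by rwa [hj'])
        (fun t ht ↦ by rw [hj']; exact hA t (ht.trans (not_lt.1 h)))).trans ?_
      simp [Set.indicator, h]
  have hint : ∀ p : ℕ, Integrable (fun ω ↦ A * |ξ ω| ^ p +
      B * {ω | s < |ξ ω|}.indicator (fun ω ↦ |ξ ω| ^ p) ω) μ := fun p ↦
    ((integrable_comp_of_bounded hξ hM (g := fun x ↦ |x| ^ p) (by fun_prop)).const_mul A).add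
      ((integrable_indicator_abs_pow hξ hM s p).const_mul B)
  have hintegral : ∀ p : ℕ, ∫ ω, (A * |ξ ω| ^ p +
      B * {ω | s < |ξ ω|}.indicator (fun ω ↦ |ξ ω| ^ p) ω) ∂μ =
      A * ∫ ω, |ξ ω| ^ p ∂μ + B * ∫ ω in {ω | s < |ξ ω|}, |ξ ω| ^ p ∂μ := by
    intro p
    rw [integral_add ((integrable_comp_of_bounded hξ hM (g := fun x ↦ |x| ^ p)
      (by fun_prop)).const_mul A) ((integrable_indicator_abs_pow hξ hM s p).const_mul B),
      integral_const_mul, integral_const_mul, integral_indicator hS]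
  have hfirst : |∫ ω, ξ ω * R 0 (ξ ω) ∂μ| ≤ U := by
    rw [hU, ← hintegral]
    refine norm_integral_le_of_norm_le (f := fun ω ↦ ξ ω * R 0 (ξ ω)) (hint _)
      (.of_forall fun ω ↦ ?_)
    rw [norm_mul, Real.norm_eq_abs, Real.norm_eq_abs]
    refine (mul_le_mul_of_nonneg_left (hpt 0 (by simp) ω) (abs_nonneg _)).trans_eq ?_
    by_cases h : s < |ξ ω| <;> simp [Set.indicator, h] <;> ring
  have hterm : ∀ j ∈ Finset.range (ℓ + 1),
      |iteratedDeriv (j + 1) (cgf ξ μ) 0 / (Nat.factorial j : ℝ) * ∫ ω, R j (ξ ω) ∂μ| ≤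
        2 ^ j * U := by
    intro j hj
    have hj' : j + 1 + (ℓ + 1 - j) = ℓ + 2 := by have := Finset.mem_range.1 hj; omega
    have hRj : |∫ ω, R j (ξ ω) ∂μ| ≤ A * ∫ ω, |ξ ω| ^ (ℓ + 1 - j) ∂μ +
        B * ∫ ω in {ω | s < |ξ ω|}, |ξ ω| ^ (ℓ + 1 - j) ∂μ := by
      rw [← hintegral]
      exact norm_integral_le_of_norm_le (f := fun ω ↦ R j (ξ ω)) (hint _) (.of_forall (hpt j hj))
    have hκ : |iteratedDeriv (j + 1) (cgf ξ μ) 0 / (Nat.factorial j : ℝ)| ≤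
        2 ^ j * ∫ ω, |ξ ω| ^ (j + 1) ∂μ := by
      rw [abs_div, Nat.abs_cast, div_le_iff₀ (by positivity)]
      exact (abs_cumulant_le hξ hM j).trans_eq (by ring)
    have hp := integral_abs_pow_mul_le (μ := μ) hξ hM (j + 1) (ℓ + 1 - j)
    have hq := integral_abs_pow_mul_setIntegral_le (μ := μ) hξ hM s (j + 1) (ℓ + 1 - j)
    rw [hj'] at hp hq
    rw [abs_mul]
    calc _ ≤ (2 ^ j * ∫ ω, |ξ ω| ^ (j + 1) ∂μ) * (A * ∫ ω, |ξ ω| ^ (ℓ + 1 - j) ∂μ +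
          B * ∫ ω in {ω | s < |ξ ω|}, |ξ ω| ^ (ℓ + 1 - j) ∂μ) :=
          mul_le_mul hκ hRj (abs_nonneg _) ((abs_nonneg _).trans hκ)
      _ = 2 ^ j * (A * ((∫ ω, |ξ ω| ^ (j + 1) ∂μ) * ∫ ω, |ξ ω| ^ (ℓ + 1 - j) ∂μ) +
          B * ((∫ ω, |ξ ω| ^ (j + 1) ∂μ) *
            ∫ ω in {ω | s < |ξ ω|}, |ξ ω| ^ (ℓ + 1 - j) ∂μ)) := by ring
      _ ≤ _ := by rw [hU]; gcongr
  have hsum := (Finset.abs_sum_le_sum_abs _ _).trans (Finset.sum_le_sum hterm)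
  rw [← Finset.sum_mul, geom_sum_eq (by norm_num)] at hsum
  rw [cumulantRemainder_eq hξ hM hf hR]
  refine (abs_sub _ _).trans ?_
  linarith

lemma abs_cumulantRemainder_zero_le (hξ : Measurable ξ) {M : ℝ} (hM : ∀ ω, |ξ ω| ≤ M)
    {f : ℝ → ℝ} (hf : ContDiff ℝ 1 f) {s A B : ℝ} (hs : 0 ≤ s) (hA0 : 0 ≤ A) (hB0 : 0 ≤ B)
    (hA : ∀ t, |t| ≤ s → |deriv f t| ≤ A) (hB : ∀ t, |deriv f t| ≤ B) :
    |cumulantRemainder ξ f 0 μ| ≤ A * ∫ ω, |ξ ω| ^ 2 ∂μ +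
      B * ∫ ω in {ω | s < |ξ ω|}, |ξ ω| ^ 2 ∂μ := by
  have hdiff : Differentiable ℝ f := hf.differentiable one_ne_zero
  have hκ : iteratedDeriv 1 (cgf ξ μ) 0 = ∫ ω, ξ ω ∂μ := by
    simpa using (integral_pow_succ_eq_sum_cumulant (μ := μ) hξ hM 0).symm
  have hrem : cumulantRemainder ξ f 0 μ =
      ∫ ω, ξ ω * f (ξ ω) ∂μ - (∫ ω, ξ ω ∂μ) * ∫ ω, f (ξ ω) ∂μ := by
    simp [cumulantRemainder, hκ, -iteratedDeriv_one]
  rw [hrem]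
  refine abs_integral_mul_sub_le hξ hM hf.continuous hs hA0 hB0 (fun x y hx hy ↦ ?_)
    fun x y ↦ ?_
  · exact Convex.norm_image_sub_le_of_norm_deriv_le (fun z _ ↦ hdiff z)
      (fun z hz ↦ hA z (abs_le.2 hz)) (convex_Icc (-s) s) (abs_le.1 hy) (abs_le.1 hx)
  · exact Convex.norm_image_sub_le_of_norm_deriv_le (fun z _ ↦ hdiff z)
      (fun z _ ↦ hB z) convex_univ (Set.mem_univ y) (Set.mem_univ x)

end

/-- Cumulant expansion formula: for `f ∈ C^{ℓ+1}(ℝ)` with bounded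
`(ℓ+1)`-st derivative and a bounded random variable `ξ` with cumulants
`κ_k(ξ) = (d/dt)^k log E e^{tξ} |_{t=0}`,
`E(ξ f(ξ)) = ∑_{k=0}^{ℓ} κ_{k+1}(ξ)/k! · E(f^{(k)}(ξ)) + E(r_ℓ)`, with the stated
remainder bound for every `s > 0` and a constant `C_ℓ ≤ (Cℓ)^ℓ/ℓ!`. -/
theorem stmt_11 :
    ∃ C : ℝ, 0 < C ∧
      ∀ ℓ : ℕ, ∃ Cℓ : ℝ, 0 ≤ Cℓ ∧ Cℓ ≤ (C * ℓ) ^ ℓ / (Nat.factorial ℓ : ℝ) ∧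
        ∀ (Ω : Type) [MeasureSpace Ω] [IsProbabilityMeasure (ℙ : Measure Ω)]
          (ξ : Ω → ℝ) (f : ℝ → ℝ), Measurable ξ → (∃ M : ℝ, ∀ ω, |ξ ω| ≤ M) →
          ContDiff ℝ (ℓ + 1) f → (∃ M : ℝ, ∀ t : ℝ, |iteratedDeriv (ℓ + 1) f t| ≤ M) →
          ∃ Rem : ℝ,
            (∫ ω, ξ ω * f (ξ ω) ∂ℙ) =
              (∑ k ∈ Finset.range (ℓ + 1),
                iteratedDeriv (k + 1) (cgf ξ ℙ) 0 / (Nat.factorial k : ℝ) *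
                  ∫ ω, iteratedDeriv k f (ξ ω) ∂ℙ) + Rem ∧
            ∀ s : ℝ, 0 < s →
              |Rem| ≤
                Cℓ * (∫ ω, |ξ ω| ^ (ℓ + 2) ∂ℙ) *
                    (⨆ u : Set.Icc (-s) s, |iteratedDeriv (ℓ + 1) f (u : ℝ)|) +
                  Cℓ * (∫ ω in {ω | s < |ξ ω|}, |ξ ω| ^ (ℓ + 2) ∂ℙ) *
                    (⨆ u : ℝ, |iteratedDeriv (ℓ + 1) f u|) := by
  refine ⟨4, by norm_num, fun ℓ ↦ ⟨4 ^ ℓ, by positivity, ?_, ?_⟩⟩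
  · rw [mul_pow, le_div_iff₀ (by positivity)]
    gcongr
    exact_mod_cast Nat.factorial_le_pow ℓ
  · rintro Ω _ _ ξ f hξ ⟨M, hM⟩ hf ⟨D, hD⟩
    refine ⟨cumulantRemainder ξ f ℓ ℙ, by rw [cumulantRemainder]; ring, fun s hs ↦ ?_⟩
    set A := ⨆ u : Set.Icc (-s) s, |iteratedDeriv (ℓ + 1) f (u : ℝ)|
    set B := ⨆ u : ℝ, |iteratedDeriv (ℓ + 1) f u|
    have hA : ∀ t, |t| ≤ s → |iteratedDeriv (ℓ + 1) f t| ≤ A := fun t ht ↦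
      le_ciSup (f := fun u : Set.Icc (-s) s ↦ |iteratedDeriv (ℓ + 1) f (u : ℝ)|)
        ⟨D, by rintro _ ⟨u, rfl⟩; exact hD u⟩ ⟨t, abs_le.1 ht⟩
    have hB : ∀ t, |iteratedDeriv (ℓ + 1) f t| ≤ B := fun t ↦
      le_ciSup (f := fun u : ℝ ↦ |iteratedDeriv (ℓ + 1) f u|)
        ⟨D, by rintro _ ⟨u, rfl⟩; exact hD u⟩ t
    have hA0 : 0 ≤ A := Real.iSup_nonneg fun _ ↦ abs_nonneg _
    have hB0 : 0 ≤ B := Real.iSup_nonneg fun _ ↦ abs_nonneg _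
    have hμ : 0 ≤ ∫ ω, |ξ ω| ^ (ℓ + 2) ∂ℙ := integral_nonneg fun ω ↦ by positivity
    have hτ : 0 ≤ ∫ ω in {ω | s < |ξ ω|}, |ξ ω| ^ (ℓ + 2) ∂ℙ :=
      integral_nonneg fun ω ↦ by positivity
    have key : |cumulantRemainder ξ f ℓ ℙ| ≤ 4 ^ ℓ * (A * ∫ ω, |ξ ω| ^ (ℓ + 2) ∂ℙ +
        B * ∫ ω in {ω | s < |ξ ω|}, |ξ ω| ^ (ℓ + 2) ∂ℙ) := by
      rcases Nat.eq_zero_or_pos ℓ with rfl | hℓ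
      · simp only [zero_add, iteratedDeriv_one] at hA hB
        simpa using abs_cumulantRemainder_zero_le hξ hM (by simpa using hf) hs.le hA0 hB0 hA hB
      · refine (abs_cumulantRemainder_le hξ hM (by exact_mod_cast hf) hA0 hB0 hA hB).trans ?_
        gcongr
        rw [show (4 : ℝ) = 2 ^ 2 by norm_num, ← pow_mul]
        exact pow_le_pow_right₀ (by norm_num) (by omega)
    linarith
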